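/- arXiv:2212.05088 — 6 statements merged into one kernel-verified Lean document; each statement's English description precedes it below -/
import Mathlib

section
/- Fix j ∈ [m]. Suppose f is differentiable and satisfies the block smoothness assumption for block j: for all x, y ∈ ℝ^d that differ only in block j, ‖∇^j f(x) − ∇^j f(y)‖_{Λ_j^{-1}} ≤ ‖x^j − y^j‖_{Λ_j}. Let x_{k−1} ∈ ℝ^d, let x_k^1, …, x_k^j be vectors with x_k^ℓ ∈ ℝ^{d_ℓ}, set x_{k−1,j} := (x_k^1, …, x_k^{j−1}, x_{k−1}^j, …, x_{k−1}^m) and x_{k−1,j+1} := (x_k^1, …, x_k^j, x_{k−1}^{j+1}, …, x_{k−1}^m), and suppose there exists s^j ∈ ∂r^j(x_k^j) with x_k^j = x_{k−1}^j − Λ_j^{-1}(∇^j f(x_{k−1,j}) + s^j). Then F(x_{k−1,j+1}) ≤ F(x_{k−1,j}) − (1/2)‖x_k^j − x_{k−1}^j‖²_{Λ_j}. -/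
open Finset

/-- Descent lemma along a block: if the partial gradient of `f` over the coordinates in `S` is
`1`-Lipschitz, with respect to the norm weighted by `γ` and its dual, along directions supported
on `S`, then `f` admits the corresponding quadratic upper bound. -/
theorem descent_of_block_smooth {ι : Type*} [Fintype ι] (S : Finset ι)
    {γ : ι → ℝ} (hγ : ∀ i, 0 < γ i)
    {f : EuclideanSpace ℝ ι → ℝ} {f' : EuclideanSpace ℝ ι → EuclideanSpace ℝ ι}
    (hf : ∀ x, HasGradientAt f (f' x) x)
    (hsmooth : ∀ x y : EuclideanSpace ℝ ι, (∀ i, i ∉ S → x i = y i) →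
      ∑ i ∈ S, (f' x i - f' y i) ^ 2 / γ i ≤ ∑ i ∈ S, γ i * (x i - y i) ^ 2)
    (x h : EuclideanSpace ℝ ι) (hh : ∀ i, i ∉ S → h i = 0) :
    f (x + h) ≤ f x + ∑ i ∈ S, f' x i * h i + (1 / 2) * ∑ i ∈ S, γ i * h i ^ 2 := by
  have inner_eq : ∀ g : EuclideanSpace ℝ ι, inner ℝ g h = ∑ i ∈ S, g i * h i := by
    intro g
    rw [PiLp.inner_apply, ← Finset.sum_subset (Finset.subset_univ S)]
    · exact Finset.sum_congr rfl fun i _ => by simp [mul_comm]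
    · intro i _ hi
      simp [hh i hi]
  set Q := ∑ i ∈ S, γ i * h i ^ 2 with hQ
  set L := ∑ i ∈ S, f' x i * h i with hL
  have hderiv : ∀ t : ℝ, HasDerivAt (fun t : ℝ => f (x + t • h) - t * L - t ^ 2 / 2 * Q)
      ((∑ i ∈ S, f' (x + t • h) i * h i) - L - t * Q) t := by
    intro t
    have hline : HasDerivAt (fun t : ℝ => x + t • h) h t := by
      simpa using ((hasDerivAt_id t).smul_const h).const_add x
    have hcomp := (hf (x + t • h)).hasFDerivAt.comp_hasDerivAt t hline
    rw [InnerProductSpace.toDual_apply_apply, inner_eq] at hcomp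
    have hlin : HasDerivAt (fun t : ℝ => t * L) L t := by
      simpa using (hasDerivAt_id t).mul_const L
    have hquad : HasDerivAt (fun t : ℝ => t ^ 2 / 2 * Q) (t * Q) t := by
      simpa using ((hasDerivAt_pow 2 t).div_const 2).mul_const Q
    exact (hcomp.sub hlin).sub hquad
  have hanti : AntitoneOn (fun t : ℝ => f (x + t • h) - t * L - t ^ 2 / 2 * Q)
      (Set.Icc 0 1) := by
    refine antitoneOn_of_deriv_nonpos (convex_Icc 0 1)
      (fun t _ => (hderiv t).continuousAt.continuousWithinAt)
      (fun t _ => (hderiv t).differentiableAt.differentiableWithinAt) fun t ht => ?_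
    rw [interior_Icc] at ht
    have ht0 : 0 < t := ht.1
    rw [(hderiv t).deriv]
    have hsm := hsmooth (x + t • h) x fun i hi => by simp [hh i hi]
    have hscale : ∑ i ∈ S, γ i * ((x + t • h) i - x i) ^ 2 = t ^ 2 * Q := by
      rw [hQ, Finset.mul_sum]
      refine Finset.sum_congr rfl fun i _ => ?_
      simp only [PiLp.add_apply, PiLp.smul_apply, smul_eq_mul]
      ring
    rw [hscale] at hsm
    -- Young's inequality with weight `t`, multiplied by `2 * t`.
    have hyoung : 2 * t * ((∑ i ∈ S, f' (x + t • h) i * h i) - L) ≤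
        (∑ i ∈ S, (f' (x + t • h) i - f' x i) ^ 2 / γ i) + t ^ 2 * Q := by
      rw [hQ, hL, ← Finset.sum_sub_distrib, Finset.mul_sum, Finset.mul_sum,
        ← Finset.sum_add_distrib]
      refine Finset.sum_le_sum fun i _ => ?_
      have hpos := hγ i
      have hsq : 0 ≤ (f' (x + t • h) i - f' x i - t * γ i * h i) ^ 2 / γ i := by positivity
      have hexp : (f' (x + t • h) i - f' x i - t * γ i * h i) ^ 2 / γ i =
          (f' (x + t • h) i - f' x i) ^ 2 / γ i + t ^ 2 * (γ i * h i ^ 2)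
            - 2 * t * (f' (x + t • h) i * h i - f' x i * h i) := by
        field_simp
        ring
      linarith
    have hmul : t * ((∑ i ∈ S, f' (x + t • h) i * h i) - L - t * Q) ≤ 0 := by
      nlinarith
    exact nonpos_of_mul_nonpos_right hmul ht0
  have hle := hanti (Set.left_mem_Icc.2 zero_le_one) (Set.right_mem_Icc.2 zero_le_one)
    zero_le_one
  norm_num at hle
  linarith

/-- **One-block descent for P-CCD.** Coordinates `{1,…,d}` are partitioned into `m`
consecutive blocks via the monotone surjection `bl : Fin d → Fin m`; `γ` is the
(positive) diagonal of `Λ`, so `Λ_j` has diagonal entries `γ i` for `bl i = j`.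
`R j` plays the role of `x ↦ r^j(x^j)` (it is convex and depends only on block `j`),
`F = f + ∑ j, R j`, and the vector `s` plays the role of the subgradient
`s^j ∈ ∂r^j(x_k^j)` (only its block-`j` entries are used).  If block `j` of `xk`
is obtained from `xkm1` by the proximal block update at `xmidj = x_{k−1,j}`, then
`F(x_{k−1,j+1}) ≤ F(x_{k−1,j}) − (1/2)‖x_k^j − x_{k−1}^j‖²_{Λ_j}`. -/
theorem stmt_1 (d m : ℕ) (hm : 1 ≤ m)
    (bl : Fin d → Fin m) (hmono : Monotone bl) (hsurj : Function.Surjective bl)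
    (γ : Fin d → ℝ) (hγ : ∀ i, 0 < γ i)
    (f : EuclideanSpace ℝ (Fin d) → ℝ)
    (f' : EuclideanSpace ℝ (Fin d) → EuclideanSpace ℝ (Fin d))
    (hf : ∀ x, HasGradientAt f (f' x) x)
    (R : Fin m → EuclideanSpace ℝ (Fin d) → ℝ)
    (hRdep : ∀ (j : Fin m) (x y : EuclideanSpace ℝ (Fin d)),
      (∀ i, bl i = j → x i = y i) → R j x = R j y)
    (hRconv : ∀ j, ConvexOn ℝ Set.univ (R j))
    (j : Fin m)
    (hsmooth : ∀ x y : EuclideanSpace ℝ (Fin d), (∀ i, bl i ≠ j → x i = y i) →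
      Real.sqrt (∑ i ∈ univ.filter (fun i => bl i = j), (f' x i - f' y i) ^ 2 / γ i) ≤
        Real.sqrt (∑ i ∈ univ.filter (fun i => bl i = j), γ i * (x i - y i) ^ 2))
    (xkm1 xk : EuclideanSpace ℝ (Fin d))
    (xmidj xmidj1 : EuclideanSpace ℝ (Fin d))
    (hxmidj : ∀ i, xmidj i = if bl i < j then xk i else xkm1 i)
    (hxmidj1 : ∀ i, xmidj1 i = if bl i ≤ j then xk i else xkm1 i)
    (s : Fin d → ℝ)
    (hsub : ∀ z : EuclideanSpace ℝ (Fin d),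
      R j xk + ∑ i ∈ univ.filter (fun i => bl i = j), s i * (z i - xk i) ≤ R j z)
    (hupd : ∀ i, bl i = j → xk i = xkm1 i - (1 / γ i) * (f' xmidj i + s i)) :
    f xmidj1 + ∑ j', R j' xmidj1 ≤
      f xmidj + ∑ j', R j' xmidj
        - (1 / 2) * ∑ i ∈ univ.filter (fun i => bl i = j), γ i * (xk i - xkm1 i) ^ 2 := by
  have hdiff : ∀ i, bl i = j → (xmidj1 - xmidj) i = xk i - xkm1 i := by
    intro i hi
    simp [hxmidj, hxmidj1, hi]
  have hoff : ∀ i, bl i ≠ j → xmidj1 i = xmidj i := by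
    intro i hi
    simp [hxmidj, hxmidj1, lt_iff_le_and_ne, hi]
  have hdescent := descent_of_block_smooth (univ.filter fun i => bl i = j) hγ hf
    (fun x y hxy => (Real.sqrt_le_sqrt_iff (Finset.sum_nonneg fun i _ =>
      mul_nonneg (hγ i).le (sq_nonneg _))).1 (hsmooth x y fun i hi => hxy i (by simpa using hi)))
    xmidj (xmidj1 - xmidj)
    (fun i hi => by simp [hoff i (by simpa using hi)])
  rw [add_sub_cancel] at hdescent
  have hquad : ∑ i ∈ univ.filter (fun i => bl i = j), γ i * (xmidj1 - xmidj) i ^ 2 =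
      ∑ i ∈ univ.filter (fun i => bl i = j), γ i * (xk i - xkm1 i) ^ 2 :=
    Finset.sum_congr rfl fun i hi => by rw [hdiff i (Finset.mem_filter.1 hi).2]
  have hopt : ∑ i ∈ univ.filter (fun i => bl i = j), f' xmidj i * (xmidj1 - xmidj) i =
      ∑ i ∈ univ.filter (fun i => bl i = j), s i * (xmidj i - xk i)
        - ∑ i ∈ univ.filter (fun i => bl i = j), γ i * (xk i - xkm1 i) ^ 2 := by
    rw [← Finset.sum_sub_distrib]
    refine Finset.sum_congr rfl fun i hi => ?_
    have hij := (Finset.mem_filter.1 hi).2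
    have hmid : xmidj i = xkm1 i := by simp [hxmidj, hij]
    have hgrad : f' xmidj i = -(γ i * (xk i - xkm1 i)) - s i := by
      have hpos := (hγ i).ne'
      rw [hupd i hij]
      field_simp
      ring
    rw [hdiff i hij, hmid, hgrad]
    ring
  have hRj : R j xmidj1 = R j xk := hRdep j _ _ fun i hi => by simp [hxmidj1, hi]
  have hRrest : ∑ j' ∈ univ.erase j, R j' xmidj1 = ∑ j' ∈ univ.erase j, R j' xmidj :=
    Finset.sum_congr rfl fun j' hj' => hRdep j' _ _ fun i hi =>
      hoff i (hi ▸ Finset.ne_of_mem_erase hj')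
  rw [← Finset.add_sum_erase univ (fun j' => R j' xmidj1) (Finset.mem_univ j),
    ← Finset.add_sum_erase univ (fun j' => R j' xmidj) (Finset.mem_univ j), hRrest, hRj]
  have hsubmid := hsub xmidj
  rw [hquad, hopt] at hdescent
  linarith
end

section
/- Suppose f is differentiable and satisfies the block smoothness assumption: for every j ∈ [m] and all x, y ∈ ℝ^d that differ only in block j, ‖∇^j f(x) − ∇^j f(y)‖_{Λ_j^{-1}} ≤ ‖x^j − y^j‖_{Λ_j}. If x_k is obtained from x_{k−1} ∈ ℝ^d by one P-CCD cycle, then F(x_k) ≤ F(x_{k−1}) − (1/2)‖x_k − x_{k−1}‖²_Λ. -/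
open Finset

/-- Weighted Young inequality for sums, in the form that bounds `∑ a i * v i` by
`t * ∑ γ i * v i ^ 2` when the dual weighted norm of `a` is at most the weighted norm of `t • v`. -/
lemma sum_mul_le_of_sum_sq_div_le {ι : Type*} (S : Finset ι) (γ a v : ι → ℝ)
    (hγ : ∀ i, 0 < γ i) {t : ℝ} (ht : 0 < t)
    (h : ∑ i ∈ S, a i ^ 2 / γ i ≤ ∑ i ∈ S, γ i * (t * v i) ^ 2) :
    ∑ i ∈ S, a i * v i ≤ t * ∑ i ∈ S, γ i * v i ^ 2 := by
  have hpt : ∀ i ∈ S, t * (a i * v i) ≤ (a i ^ 2 / γ i + γ i * (t * v i) ^ 2) / 2 := by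
    intro i _
    have hi := hγ i
    have hsq : a i ^ 2 / γ i + γ i * (t * v i) ^ 2 - 2 * (t * (a i * v i)) =
        (a i - γ i * (t * v i)) ^ 2 / γ i := by
      field_simp
      ring
    have : 0 ≤ (a i - γ i * (t * v i)) ^ 2 / γ i := by positivity
    linarith
  have hsum := Finset.sum_le_sum hpt
  rw [← Finset.mul_sum, ← Finset.sum_div, Finset.sum_add_distrib] at hsum
  have hscale : ∑ i ∈ S, γ i * (t * v i) ^ 2 = t * (t * ∑ i ∈ S, γ i * v i ^ 2) := by
    simp only [Finset.mul_sum]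
    exact Finset.sum_congr rfl fun i _ => by ring
  refine le_of_mul_le_mul_left ?_ ht
  linarith

/-- Descent lemma along a set `S` of coordinates, for a gradient that is `1`-Lipschitz in the
norms weighted by `γ`. -/
lemma descent_along_coordinates {ι : Type*} [Fintype ι] (S : Finset ι)
    (γ : ι → ℝ) (hγ : ∀ i, 0 < γ i)
    (f : EuclideanSpace ℝ ι → ℝ) (f' : EuclideanSpace ℝ ι → EuclideanSpace ℝ ι)
    (hf : ∀ x, HasGradientAt f (f' x) x) (x y : EuclideanSpace ℝ ι)
    (hxy : ∀ i, i ∉ S → y i = x i)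
    (hsmooth : ∀ z : EuclideanSpace ℝ ι, (∀ i, i ∉ S → z i = x i) →
      ∑ i ∈ S, (f' z i - f' x i) ^ 2 / γ i ≤ ∑ i ∈ S, γ i * (z i - x i) ^ 2) :
    f y ≤ f x + ∑ i ∈ S, f' x i * (y i - x i) + (1 / 2) * ∑ i ∈ S, γ i * (y i - x i) ^ 2 := by
  set L := ∑ i ∈ S, f' x i * (y i - x i)
  set Q := ∑ i ∈ S, γ i * (y i - x i) ^ 2
  have hinner : ∀ z, inner ℝ (f' z) (y - x) = ∑ i ∈ S, f' z i * (y i - x i) := by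
    intro z
    rw [PiLp.inner_apply, ← Finset.sum_subset (Finset.subset_univ S)]
    · exact Finset.sum_congr rfl fun i _ => by simp [mul_comm]
    · intro i _ hi
      simp [hxy i hi]
  let g : ℝ → ℝ := fun t => f (x + t • (y - x)) - t * L - t ^ 2 / 2 * Q
  have hg : ∀ t, HasDerivAt g
      (∑ i ∈ S, f' (x + t • (y - x)) i * (y i - x i) - L - t * Q) t := by
    intro t
    have hline : HasDerivAt (fun t : ℝ => x + t • (y - x)) (y - x) t := by
      simpa using ((hasDerivAt_id t).smul_const (y - x)).const_add x
    have hcomp := (hf (x + t • (y - x))).hasFDerivAt.comp_hasDerivAt t hline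
    rw [InnerProductSpace.toDual_apply_apply, hinner] at hcomp
    have hlin : HasDerivAt (fun t : ℝ => t * L) L t := by
      simpa using (hasDerivAt_id t).mul_const L
    have hquad : HasDerivAt (fun t : ℝ => t ^ 2 / 2 * Q) (t * Q) t := by
      have := (((hasDerivAt_id t).pow 2).div_const 2).mul_const Q
      simpa using this
    exact (hcomp.sub hlin).sub hquad
  have hanti : AntitoneOn g (Set.Icc 0 1) := by
    refine antitoneOn_of_deriv_nonpos (convex_Icc 0 1)
      (fun t _ => (hg t).continuousAt.continuousWithinAt)
      (fun t _ => (hg t).differentiableAt.differentiableWithinAt) ?_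
    intro t ht
    rw [interior_Icc] at ht
    rw [(hg t).deriv]
    have hz := hsmooth (x + t • (y - x)) fun i hi => by simp [hxy i hi]
    have hbound := sum_mul_le_of_sum_sq_div_le S γ
      (fun i => f' (x + t • (y - x)) i - f' x i) (fun i => y i - x i) hγ ht.1
      (by simpa using hz)
    simp only [sub_mul, Finset.sum_sub_distrib] at hbound
    linarith
  have h01 := hanti (Set.left_mem_Icc.2 zero_le_one) (Set.right_mem_Icc.2 zero_le_one) zero_le_one
  simp only [g, one_smul, zero_smul, add_sub_cancel, add_zero] at h01
  linarith

/-- **Full-cycle descent for P-CCD.** Coordinates are partitioned into `m`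
consecutive blocks via the monotone surjection `bl`; `γ` is the positive diagonal of
`Λ`; `R j` plays the role of `x ↦ r^j(x^j)` and `F = f + ∑ j, R j`.  If `xk` is
obtained from `xkm1` by one P-CCD cycle (with `xmid j = x_{k−1,j}`), then
`F(x_k) ≤ F(x_{k−1}) − (1/2)‖x_k − x_{k−1}‖²_Λ`. -/
theorem stmt_2 (d m : ℕ) (hm : 1 ≤ m)
    (bl : Fin d → Fin m) (hmono : Monotone bl) (hsurj : Function.Surjective bl)
    (γ : Fin d → ℝ) (hγ : ∀ i, 0 < γ i)
    (f : EuclideanSpace ℝ (Fin d) → ℝ)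
    (f' : EuclideanSpace ℝ (Fin d) → EuclideanSpace ℝ (Fin d))
    (hf : ∀ x, HasGradientAt f (f' x) x)
    (R : Fin m → EuclideanSpace ℝ (Fin d) → ℝ)
    (hRdep : ∀ (j : Fin m) (x y : EuclideanSpace ℝ (Fin d)),
      (∀ i, bl i = j → x i = y i) → R j x = R j y)
    (hRconv : ∀ j, ConvexOn ℝ Set.univ (R j))
    (hsmooth : ∀ (j : Fin m) (x y : EuclideanSpace ℝ (Fin d)),
      (∀ i, bl i ≠ j → x i = y i) →
      Real.sqrt (∑ i ∈ univ.filter (fun i => bl i = j), (f' x i - f' y i) ^ 2 / γ i) ≤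
        Real.sqrt (∑ i ∈ univ.filter (fun i => bl i = j), γ i * (x i - y i) ^ 2))
    (xkm1 xk : EuclideanSpace ℝ (Fin d))
    (xmid : Fin m → EuclideanSpace ℝ (Fin d))
    (hxmid : ∀ (j : Fin m) (i : Fin d), xmid j i = if bl i < j then xk i else xkm1 i)
    (hcycle : ∀ j : Fin m, ∃ s : Fin d → ℝ,
      (∀ z : EuclideanSpace ℝ (Fin d),
        R j xk + ∑ i ∈ univ.filter (fun i => bl i = j), s i * (z i - xk i) ≤ R j z) ∧
      ∀ i, bl i = j → xk i = xkm1 i - (1 / γ i) * (f' (xmid j) i + s i)) :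
    f xk + ∑ j, R j xk ≤
      f xkm1 + ∑ j, R j xkm1 - (1 / 2) * ∑ i, γ i * (xk i - xkm1 i) ^ 2 := by
  let w : ℕ → EuclideanSpace ℝ (Fin d) := fun k =>
    WithLp.toLp 2 fun i => if (bl i : ℕ) < k then xk i else xkm1 i
  have hw : ∀ k i, w k i = if (bl i : ℕ) < k then xk i else xkm1 i := fun _ _ => rfl
  have hw_zero : w 0 = xkm1 := by
    ext i
    simp [hw]
  have hw_last : w m = xk := by
    ext i
    simp [hw]
  have hw_mid : ∀ j : Fin m, xmid j = w j := by
    intro j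
    ext i
    simp only [hw, hxmid, Fin.lt_def]
  have hblock : ∀ j : Fin m, f (w (j + 1)) - f (w j) ≤ R j xkm1 - R j xk -
      (1 / 2) * ∑ i ∈ univ.filter (fun i => bl i = j), γ i * (xk i - xkm1 i) ^ 2 := by
    intro j
    obtain ⟨s, hs, hstep⟩ := hcycle j
    have hdescent := descent_along_coordinates (univ.filter fun i => bl i = j) γ hγ f f' hf
      (w j) (w (j + 1))
      (fun i hi => by
        have hne : (bl i : ℕ) ≠ j := fun h => hi (by simpa using Fin.ext h)
        have hiff : (bl i : ℕ) < j + 1 ↔ (bl i : ℕ) < j := by omega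
        simp only [hw, hiff])
      (fun z hz => (Real.sqrt_le_sqrt_iff
        (Finset.sum_nonneg fun i _ => mul_nonneg (hγ i).le (sq_nonneg _))).1
        (hsmooth j z (w j) fun i hi => hz i (by simpa using hi)))
    have hdiff : ∀ i ∈ univ.filter (fun i => bl i = j),
        w (j + 1) i - w j i = xk i - xkm1 i := by
      intro i hi
      have hij : bl i = j := by simpa using hi
      simp [hw, hij]
    have hlin : ∑ i ∈ univ.filter (fun i => bl i = j), f' (w j) i * (w (j + 1) i - w j i) =
        ∑ i ∈ univ.filter (fun i => bl i = j), f' (w j) i * (xk i - xkm1 i) :=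
      Finset.sum_congr rfl fun i hi => by rw [hdiff i hi]
    have hquad : ∑ i ∈ univ.filter (fun i => bl i = j), γ i * (w (j + 1) i - w j i) ^ 2 =
        ∑ i ∈ univ.filter (fun i => bl i = j), γ i * (xk i - xkm1 i) ^ 2 :=
      Finset.sum_congr rfl fun i hi => by rw [hdiff i hi]
    rw [hlin, hquad] at hdescent
    have hsub : ∑ i ∈ univ.filter (fun i => bl i = j), s i * (xkm1 i - xk i) =
        ∑ i ∈ univ.filter (fun i => bl i = j), f' (w j) i * (xk i - xkm1 i) +
        ∑ i ∈ univ.filter (fun i => bl i = j), γ i * (xk i - xkm1 i) ^ 2 := by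
      rw [← Finset.sum_add_distrib]
      refine Finset.sum_congr rfl fun i hi => ?_
      have hi' := hstep i (by simpa using hi)
      have hpos := hγ i
      have hs_eq : s i = -(γ i * (xk i - xkm1 i)) - f' (w j) i := by
        rw [hi', hw_mid]
        field_simp
        ring
      rw [hs_eq]
      ring
    have hsubgrad := hs xkm1
    linarith
  have hsum := Finset.sum_le_sum fun j (_ : j ∈ (univ : Finset (Fin m))) => hblock j
  rw [Fin.sum_univ_eq_sum_range (fun k => f (w (k + 1)) - f (w k)) m,
    Finset.sum_range_sub (fun k => f (w k)) m, hw_zero, hw_last, Finset.sum_sub_distrib,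
    Finset.sum_sub_distrib, ← Finset.mul_sum,
    Finset.sum_fiberwise univ bl fun i => γ i * (xk i - xkm1 i) ^ 2] at hsum
  linarith
end

section
/- Suppose f is differentiable and satisfies the block smoothness assumption: for every j ∈ [m] and all x, y ∈ ℝ^d that differ only in block j, ‖∇^j f(x) − ∇^j f(y)‖_{Λ_j^{-1}} ≤ ‖x^j − y^j‖_{Λ_j}. Let x* ∈ ℝ^d be a global minimizer of F, and let x_0, x_1, …, x_k be a sequence in ℝ^d such that each x_i is obtained from x_{i−1} by one P-CCD cycle. Then Σ_{i=1}^k ‖x_i − x_{i−1}‖²_Λ ≤ 2(F(x_0) − F(x*)). -/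
open Finset

/-- Along a segment whose direction is supported in one block, a function with block-Lipschitz
gradient lies below its quadratic upper model. -/
theorem block_descent {d m : ℕ} (bl : Fin d → Fin m) (γ : Fin d → ℝ) (hγ : ∀ i, 0 < γ i)
    (f : EuclideanSpace ℝ (Fin d) → ℝ)
    (f' : EuclideanSpace ℝ (Fin d) → EuclideanSpace ℝ (Fin d))
    (hf : ∀ x, HasGradientAt f (f' x) x) (j : Fin m)
    (hsmooth : ∀ x y : EuclideanSpace ℝ (Fin d), (∀ i, bl i ≠ j → x i = y i) →
      Real.sqrt (∑ i ∈ univ.filter (fun i => bl i = j), (f' x i - f' y i) ^ 2 / γ i) ≤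
        Real.sqrt (∑ i ∈ univ.filter (fun i => bl i = j), γ i * (x i - y i) ^ 2))
    (x y : EuclideanSpace ℝ (Fin d)) (hxy : ∀ i, bl i ≠ j → y i = x i) :
    f y ≤ f x + ∑ i ∈ univ.filter (fun i => bl i = j), f' x i * (y i - x i) +
      (∑ i ∈ univ.filter (fun i => bl i = j), γ i * (y i - x i) ^ 2) / 2 := by
  set S := univ.filter (fun i => bl i = j)
  set L := ∑ i ∈ S, f' x i * (y i - x i) with hL
  set Q := ∑ i ∈ S, γ i * (y i - x i) ^ 2 with hQ
  have hderiv : ∀ t : ℝ, HasDerivAt (fun t : ℝ => f (x + t • (y - x)) - t * L - t ^ 2 / 2 * Q)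
      (∑ i ∈ S, f' (x + t • (y - x)) i * (y i - x i) - L - t * Q) t := by
    intro t
    have hline : HasDerivAt (fun t : ℝ => x + t • (y - x)) (y - x) t := by
      simpa using ((hasDerivAt_id t).smul_const (y - x)).const_add x
    have hcomp := (hf (x + t • (y - x))).hasFDerivAt.comp_hasDerivAt t hline
    have hinner : inner ℝ (f' (x + t • (y - x))) (y - x) =
        ∑ i ∈ S, f' (x + t • (y - x)) i * (y i - x i) := by
      rw [PiLp.inner_apply, ← Finset.sum_subset (Finset.subset_univ S)]
      · simp [mul_comm]
      · intro i _ hi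
        have hij : bl i ≠ j := by simpa [S] using hi
        simp [hxy i hij]
    rw [InnerProductSpace.toDual_apply_apply, hinner] at hcomp
    refine (hcomp.sub ((hasDerivAt_id t).mul_const L)).sub
      ((((hasDerivAt_id t).pow 2).div_const 2).mul_const Q) |>.congr_deriv ?_
    simp
  have hanti : AntitoneOn (fun t : ℝ => f (x + t • (y - x)) - t * L - t ^ 2 / 2 * Q)
      (Set.Icc 0 1) := by
    refine antitoneOn_of_deriv_nonpos (convex_Icc 0 1)
      (fun t _ => (hderiv t).continuousAt.continuousWithinAt)
      (fun t _ => (hderiv t).differentiableAt.differentiableWithinAt) ?_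
    intro t ht
    rw [interior_Icc] at ht
    have ht0 : 0 < t := ht.1
    rw [(hderiv t).deriv]
    set u := x + t • (y - x) with hu
    have hlip : ∑ i ∈ S, (f' u i - f' x i) ^ 2 / γ i ≤ t ^ 2 * Q := by
      have h := hsmooth u x (fun i hi => by simp [hu, hxy i hi])
      rw [Real.sqrt_le_sqrt_iff
        (Finset.sum_nonneg fun i _ => mul_nonneg (hγ i).le (sq_nonneg _))] at h
      refine h.trans_eq ?_
      rw [hQ, Finset.mul_sum]
      refine Finset.sum_congr rfl fun i _ => ?_
      simp [hu]
      ring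
    have hyoung : ∑ i ∈ S, (f' u i - f' x i) * (y i - x i) ≤
        ∑ i ∈ S, ((f' u i - f' x i) ^ 2 / γ i / (2 * t) + t / 2 * (γ i * (y i - x i) ^ 2)) := by
      refine Finset.sum_le_sum fun i _ => ?_
      have hγi := hγ i
      rw [← sub_nonneg]
      have : (f' u i - f' x i) ^ 2 / γ i / (2 * t) + t / 2 * (γ i * (y i - x i) ^ 2) -
          (f' u i - f' x i) * (y i - x i) =
          ((f' u i - f' x i) - t * γ i * (y i - x i)) ^ 2 / (2 * t * γ i) := by
        field_simp
        ring
      rw [this]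
      positivity
    rw [Finset.sum_add_distrib, ← Finset.sum_div, ← Finset.mul_sum, ← hQ] at hyoung
    have hdiv : (∑ i ∈ S, (f' u i - f' x i) ^ 2 / γ i) / (2 * t) ≤ t / 2 * Q := by
      rw [div_le_iff₀ (by positivity)]
      linarith
    have hsplit : ∑ i ∈ S, (f' u i - f' x i) * (y i - x i) =
        ∑ i ∈ S, f' u i * (y i - x i) - L := by
      rw [hL, ← Finset.sum_sub_distrib]
      exact Finset.sum_congr rfl fun i _ => by ring
    linarith
  have h := hanti (Set.left_mem_Icc.2 zero_le_one) (Set.right_mem_Icc.2 zero_le_one) zero_le_one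
  simp at h
  linarith

/-- **Lemma 3 (telescoped descent for P-CCD).** Coordinates are partitioned into `m`
consecutive blocks via the monotone surjection `bl`; `γ` is the positive diagonal of
`Λ`; `R j` plays the role of `x ↦ r^j(x^j)` and `F = f + ∑ j, R j`; `xstar` is a
global minimizer of `F`.  If each `x (k+1)` (for `k < K`) is obtained from `x k` by
one P-CCD cycle, then `∑_{i=1}^K ‖x_i − x_{i−1}‖²_Λ ≤ 2(F(x_0) − F(x*))`. -/
theorem stmt_3 (d m : ℕ) (hm : 1 ≤ m)
    (bl : Fin d → Fin m) (hmono : Monotone bl) (hsurj : Function.Surjective bl)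
    (γ : Fin d → ℝ) (hγ : ∀ i, 0 < γ i)
    (f : EuclideanSpace ℝ (Fin d) → ℝ)
    (f' : EuclideanSpace ℝ (Fin d) → EuclideanSpace ℝ (Fin d))
    (hf : ∀ x, HasGradientAt f (f' x) x)
    (R : Fin m → EuclideanSpace ℝ (Fin d) → ℝ)
    (hRdep : ∀ (j : Fin m) (x y : EuclideanSpace ℝ (Fin d)),
      (∀ i, bl i = j → x i = y i) → R j x = R j y)
    (hRconv : ∀ j, ConvexOn ℝ Set.univ (R j))
    (hsmooth : ∀ (j : Fin m) (x y : EuclideanSpace ℝ (Fin d)),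
      (∀ i, bl i ≠ j → x i = y i) →
      Real.sqrt (∑ i ∈ univ.filter (fun i => bl i = j), (f' x i - f' y i) ^ 2 / γ i) ≤
        Real.sqrt (∑ i ∈ univ.filter (fun i => bl i = j), γ i * (x i - y i) ^ 2))
    (xstar : EuclideanSpace ℝ (Fin d))
    (hstar : ∀ y, f xstar + ∑ j, R j xstar ≤ f y + ∑ j, R j y)
    (K : ℕ)
    (x : ℕ → EuclideanSpace ℝ (Fin d))
    (xmid : ℕ → Fin m → EuclideanSpace ℝ (Fin d))
    (hxmid : ∀ (k : ℕ) (j : Fin m) (i : Fin d),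
      xmid k j i = if bl i < j then x (k + 1) i else x k i)
    (hcycle : ∀ k < K, ∀ j : Fin m, ∃ s : Fin d → ℝ,
      (∀ z : EuclideanSpace ℝ (Fin d),
        R j (x (k + 1)) +
          ∑ i ∈ univ.filter (fun i => bl i = j), s i * (z i - x (k + 1) i) ≤ R j z) ∧
      ∀ i, bl i = j → x (k + 1) i = x k i - (1 / γ i) * (f' (xmid k j) i + s i)) :
    ∑ k ∈ Finset.range K, ∑ i, γ i * (x (k + 1) i - x k i) ^ 2 ≤
      2 * ((f (x 0) + ∑ j, R j (x 0)) - (f xstar + ∑ j, R j xstar)) := by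
  have hcycle_descent : ∀ k < K, ∑ i, γ i * (x (k + 1) i - x k i) ^ 2 ≤
      2 * ((f (x k) + ∑ j, R j (x k)) - (f (x (k + 1)) + ∑ j, R j (x (k + 1)))) := by
    intro k hk
    let w : ℕ → EuclideanSpace ℝ (Fin d) := fun n =>
      WithLp.toLp 2 fun i => if (bl i : ℕ) < n then x (k + 1) i else x k i
    have hw : ∀ n i, w n i = if (bl i : ℕ) < n then x (k + 1) i else x k i := fun _ _ => rfl
    have hw_zero : w 0 = x k := by
      ext i
      simp [hw]
    have hw_last : w m = x (k + 1) := by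
      ext i
      simp [hw]
    have hblock : ∀ j : Fin m,
        ∑ i ∈ univ.filter (fun i => bl i = j), γ i * (x (k + 1) i - x k i) ^ 2 ≤
          2 * ((f (w j) - f (w (j + 1))) + (R j (x k) - R j (x (k + 1)))) := by
      intro j
      obtain ⟨s, hs, hstep⟩ := hcycle k hk j
      have hmid : xmid k j = w j := by
        ext i
        rw [hxmid, hw]
        rfl
      have hdesc := block_descent bl γ hγ f f' hf j (hsmooth j) (w j) (w (j + 1)) (by
        intro i hi
        have hne : (bl i : ℕ) ≠ j := fun h => hi (Fin.ext h)
        rw [hw, hw]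
        exact if_congr (by omega) rfl rfl)
      have hdiff : ∀ i, bl i = j → w (j + 1) i - w j i = x (k + 1) i - x k i := by
        intro i hi
        simp [hw, hi]
      have hlin : ∑ i ∈ univ.filter (fun i => bl i = j), f' (w j) i * (w (j + 1) i - w j i) =
          ∑ i ∈ univ.filter (fun i => bl i = j), f' (w j) i * (x (k + 1) i - x k i) :=
        Finset.sum_congr rfl fun i hi => by rw [hdiff i (Finset.mem_filter.1 hi).2]
      have hquad : ∑ i ∈ univ.filter (fun i => bl i = j), γ i * (w (j + 1) i - w j i) ^ 2 =
          ∑ i ∈ univ.filter (fun i => bl i = j), γ i * (x (k + 1) i - x k i) ^ 2 :=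
        Finset.sum_congr rfl fun i hi => by rw [hdiff i (Finset.mem_filter.1 hi).2]
      have hsub : ∑ i ∈ univ.filter (fun i => bl i = j), s i * (x k i - x (k + 1) i) =
          ∑ i ∈ univ.filter (fun i => bl i = j), γ i * (x (k + 1) i - x k i) ^ 2 +
          ∑ i ∈ univ.filter (fun i => bl i = j), f' (w j) i * (x (k + 1) i - x k i) := by
        rw [← Finset.sum_add_distrib]
        refine Finset.sum_congr rfl fun i hi => ?_
        have h := hstep i (Finset.mem_filter.1 hi).2
        rw [hmid] at h
        have hγi := (hγ i).ne'
        have hsi : s i = γ i * (x k i - x (k + 1) i) - f' (w j) i := by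
          rw [h]
          field_simp
          ring
        rw [hsi]
        ring
      have hR := hs (x k)
      rw [hlin, hquad] at hdesc
      rw [hsub] at hR
      linarith
    have htel : ∑ j : Fin m, (f (w j) - f (w (j + 1))) = f (x k) - f (x (k + 1)) := by
      rw [Fin.sum_univ_eq_sum_range (fun n => f (w n) - f (w (n + 1))) m,
        Finset.sum_range_sub', hw_zero, hw_last]
    have hsum := Finset.sum_le_sum fun j (_ : j ∈ univ) => hblock j
    rw [Finset.sum_fiberwise, ← Finset.mul_sum, Finset.sum_add_distrib, htel,
      Finset.sum_sub_distrib] at hsum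
    linarith
  have hsum := Finset.sum_le_sum fun k (hk : k ∈ Finset.range K) =>
    hcycle_descent k (Finset.mem_range.1 hk)
  rw [← Finset.mul_sum,
    Finset.sum_range_sub' (fun k => f (x k) + ∑ j, R j (x k))] at hsum
  linarith [hstar (x K)]
end

section
/- Let f_1, …, f_n : ℝ^d → ℝ be differentiable, f := (1/n)Σ_{i=1}^n f_i, n ≥ 2, and let b, b' be integers with 1 ≤ b ≤ n and 1 ≤ b' ≤ n, and p ∈ [0,1]. Fix j ∈ [m], points u, w ∈ ℝ^d, and h ∈ ℝ^{d_j}. Then p·(1/C(n,b)) Σ_{B ⊆ {1,…,n}, |B| = b} ‖(1/b)Σ_{i∈B} ∇^j f_i(u) − ∇^j f(u)‖²_{Λ_j^{-1}} + (1−p)·(1/C(n,b')) Σ_{B' ⊆ {1,…,n}, |B'| = b'} ‖h + (1/b')Σ_{i∈B'} (∇^j f_i(u) − ∇^j f_i(w)) − ∇^j f(u)‖²_{Λ_j^{-1}} ≤ (p(n−b)/(b(n−1)))·(1/n)Σ_{i=1}^n ‖∇^j f_i(u) − ∇^j f(u)‖²_{Λ_j^{-1}} + (1−p)‖h − ∇^j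 f(w)‖²_{Λ_j^{-1}} + ((1−p)/b')·(1/n)Σ_{i=1}^n ‖∇^j f_i(u) − ∇^j f_i(w)‖²_{Λ_j^{-1}}, where C(n,b) is the binomial coefficient. -/
open Finset

/-- Summing over a `(l + 1)`-subset and one of its elements amounts to summing over an element
and an `l`-subset of the remaining ones. -/
theorem sum_powersetCard_succ_sum_mem {ι : Type*} [DecidableEq ι] (s : Finset ι) (l : ℕ)
    (g : ι → Finset ι → ℝ) :
    ∑ B ∈ s.powersetCard (l + 1), ∑ i ∈ B, g i B
      = ∑ i ∈ s, ∑ B ∈ (s.erase i).powersetCard l, g i (insert i B) := by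
  rw [Finset.sum_sigma', Finset.sum_sigma']
  refine Finset.sum_bij' (fun x _ => ⟨x.2, x.1.erase x.2⟩) (fun x _ => ⟨insert x.1 x.2, x.1⟩)
    ?_ ?_ ?_ ?_ ?_
  · rintro ⟨B, i⟩ hx
    simp only [mem_sigma, mem_powersetCard] at hx ⊢
    obtain ⟨⟨hBs, hB⟩, hi⟩ := hx
    exact ⟨hBs hi, erase_subset_erase i hBs, by rw [card_erase_of_mem hi, hB]; rfl⟩
  · rintro ⟨i, B⟩ hx
    simp only [mem_sigma, mem_powersetCard] at hx ⊢
    obtain ⟨hi, hBs, hB⟩ := hx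
    have hiB : i ∉ B := fun hmem => notMem_erase i s (hBs hmem)
    exact ⟨⟨insert_subset hi (hBs.trans (erase_subset i s)), by
      rw [card_insert_of_notMem hiB, hB]⟩, mem_insert_self i B⟩
  · rintro ⟨B, i⟩ hx
    simp only [mem_sigma] at hx
    simp [insert_erase hx.2]
  · rintro ⟨i, B⟩ hx
    simp only [mem_sigma, mem_powersetCard] at hx
    have hiB : i ∉ B := fun hmem => notMem_erase i s (hx.2.1 hmem)
    simp [erase_insert hiB]
  · rintro ⟨B, i⟩ hx
    simp only [mem_sigma] at hx
    simp [insert_erase hx.2]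

theorem sum_powersetCard_succ_sum {ι : Type*} [DecidableEq ι] {s : Finset ι} {k : ℕ}
    (hs : #s = k + 1) (l : ℕ) (a : ι → ℝ) :
    ∑ B ∈ s.powersetCard (l + 1), ∑ i ∈ B, a i = (k.choose l : ℝ) * ∑ i ∈ s, a i := by
  rw [sum_powersetCard_succ_sum_mem s l fun i _ => a i, mul_sum]
  refine sum_congr rfl fun i hi => ?_
  rw [sum_const, card_powersetCard, card_erase_of_mem hi, hs, nsmul_eq_mul, Nat.add_sub_cancel]

/-- Second moment of the sum over a subset of fixed size, for a family with zero total. -/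
theorem sum_powersetCard_succ_sq_sum {ι : Type*} [DecidableEq ι] {s : Finset ι} {k : ℕ}
    (hs : #s = k + 2) (l : ℕ) {a : ι → ℝ} (ha : ∑ i ∈ s, a i = 0) :
    ∑ B ∈ s.powersetCard (l + 1), (∑ i ∈ B, a i) ^ 2
      = (k.choose l : ℝ) * ∑ i ∈ s, a i ^ 2 := by
  have hexpand : ∀ B : Finset ι, (∑ i ∈ B, a i) ^ 2 = ∑ i ∈ B, a i * ∑ i' ∈ B, a i' := by
    intro B
    rw [← sum_mul, sq]
  simp only [hexpand]
  rw [sum_powersetCard_succ_sum_mem s l fun i B => a i * ∑ i' ∈ B, a i', mul_sum]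
  refine sum_congr rfl fun i hi => ?_
  have hcard : #(s.erase i) = k + 1 := by rw [card_erase_of_mem hi, hs]; rfl
  have herase : ∑ i' ∈ s.erase i, a i' = -a i := by
    linarith [add_sum_erase s a hi]
  have hinsert : ∀ B ∈ (s.erase i).powersetCard l,
      a i * ∑ i' ∈ insert i B, a i' = a i ^ 2 + a i * ∑ i' ∈ B, a i' := by
    intro B hB
    have hiB : i ∉ B := fun hmem => notMem_erase i s ((mem_powersetCard.1 hB).1 hmem)
    rw [sum_insert hiB]
    ring
  rw [sum_congr rfl hinsert, sum_add_distrib, ← mul_sum, sum_const, card_powersetCard, hcard,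
    nsmul_eq_mul]
  cases l with
  | zero => simp
  | succ l =>
    rw [sum_powersetCard_succ_sum hcard, herase, Nat.choose_succ_succ]
    push_cast
    ring

/-- Bias-variance decomposition of the mean of a sample drawn without replacement. -/
theorem average_powersetCard_sq_add_sampleMean_sub_mean {n b : ℕ} (hn : 2 ≤ n) (hb1 : 1 ≤ b)
    (hbn : b ≤ n) (a : Fin n → ℝ) (e : ℝ) :
    (1 / (n.choose b : ℝ)) * ∑ B ∈ (univ : Finset (Fin n)).powersetCard b,
        (e + ((1 / (b : ℝ)) * ∑ i ∈ B, a i - (1 / (n : ℝ)) * ∑ i, a i)) ^ 2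
      = e ^ 2 + ((n : ℝ) - b) / (b * ((n : ℝ) - 1)) *
          ((1 / (n : ℝ)) * ∑ i, (a i - (1 / (n : ℝ)) * ∑ i', a i') ^ 2) := by
  obtain ⟨k, rfl⟩ : ∃ k, n = k + 2 := ⟨n - 2, by omega⟩
  obtain ⟨l, rfl⟩ : ∃ l, b = l + 1 := ⟨b - 1, by omega⟩
  set μ : ℝ := (1 / ((k + 2 : ℕ) : ℝ)) * ∑ i, a i with hμ
  have hk : ((k + 2 : ℕ) : ℝ) ≠ 0 := by positivity
  have hl : ((l + 1 : ℕ) : ℝ) ≠ 0 := by positivity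
  have hcentered : ∑ i, (a i - μ) = 0 := by
    rw [sum_sub_distrib, sum_const, card_univ, Fintype.card_fin, nsmul_eq_mul, hμ]
    field_simp
    ring
  have hcard : #(univ : Finset (Fin (k + 2))) = k + 2 := by simp
  have hfirst := sum_powersetCard_succ_sum (k := k + 1) hcard l fun i => a i - μ
  have hsecond := sum_powersetCard_succ_sq_sum hcard l hcentered
  rw [hcentered, mul_zero] at hfirst
  have hterm : ∀ B ∈ (univ : Finset (Fin (k + 2))).powersetCard (l + 1),
      (e + ((1 / ((l + 1 : ℕ) : ℝ)) * ∑ i ∈ B, a i - μ)) ^ 2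
        = e ^ 2 + (2 * e * (1 / ((l + 1 : ℕ) : ℝ))) * ∑ i ∈ B, (a i - μ)
          + (1 / ((l + 1 : ℕ) : ℝ)) ^ 2 * (∑ i ∈ B, (a i - μ)) ^ 2 := by
    intro B hB
    rw [sum_sub_distrib, sum_const, (mem_powersetCard.1 hB).2, nsmul_eq_mul]
    field_simp
    ring
  rw [sum_congr rfl hterm, sum_add_distrib, sum_add_distrib, ← mul_sum, ← mul_sum, hfirst, hsecond,
    sum_const, card_powersetCard, hcard, nsmul_eq_mul]
  have hchoose : (((k + 2).choose (l + 1) : ℕ) : ℝ) ≠ 0 :=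
    Nat.cast_ne_zero.2 (Nat.choose_pos hbn).ne'
  have hchoose_succ : ((k : ℝ) + 2) * ((k + 1).choose l : ℝ)
      = ((k + 2).choose (l + 1) : ℝ) * (l + 1) := by
    exact_mod_cast Nat.add_one_mul_choose_eq (k + 1) l
  have hchoose_mul : (k.choose l : ℝ) * (k + 1) = ((k + 1).choose l : ℝ) * ((k : ℝ) + 1 - l) := by
    have hnat := Nat.choose_mul_succ_eq k l
    have hcast : ((k + 1 - l : ℕ) : ℝ) = (k : ℝ) + 1 - l := by
      rw [Nat.cast_sub (by omega)]
      push_cast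
      ring
    rw [← hcast]
    exact_mod_cast hnat
  have hratio : (k.choose l : ℝ) = ((k + 2).choose (l + 1) : ℝ) * (l + 1) * ((k : ℝ) + 1 - l)
      / (((k : ℝ) + 2) * (k + 1)) := by
    rw [eq_div_iff (by positivity), ← hchoose_succ]
    linear_combination ((k : ℝ) + 2) * hchoose_mul
  rw [hratio]
  have hk1 : (k : ℝ) + 1 ≠ 0 := by positivity
  have hk2 : (k : ℝ) + 2 ≠ 0 := by positivity
  have hl1 : (l : ℝ) + 1 ≠ 0 := by positivity
  have hpred : (k : ℝ) + 2 - 1 = k + 1 := by ring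
  push_cast
  rw [hpred]
  field_simp
  ring

theorem sum_sq_sub_mean_le_sum_sq {n : ℕ} (hn : n ≠ 0) (a : Fin n → ℝ) :
    ∑ i, (a i - (1 / (n : ℝ)) * ∑ i', a i') ^ 2 ≤ ∑ i, a i ^ 2 := by
  have hn0 : (n : ℝ) ≠ 0 := Nat.cast_ne_zero.2 hn
  set μ : ℝ := (1 / (n : ℝ)) * ∑ i, a i with hμ
  have hsum : ∑ i, a i = n * μ := by rw [hμ]; field_simp
  have hexpand : ∑ i, (a i - μ) ^ 2 = ∑ i, a i ^ 2 - n * μ ^ 2 := by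
    simp only [sub_sq, sum_add_distrib, sum_sub_distrib, ← sum_mul, ← mul_sum, hsum, sum_const,
      card_univ, Fintype.card_fin, nsmul_eq_mul]
    ring
  rw [hexpand]
  have : 0 ≤ (n : ℝ) * μ ^ 2 := by positivity
  linarith

theorem average_powersetCard_sq_add_sampleMean_sub_mean_le {n b : ℕ} (hn : 2 ≤ n) (hb1 : 1 ≤ b)
    (hbn : b ≤ n) (a : Fin n → ℝ) (e : ℝ) :
    (1 / (n.choose b : ℝ)) * ∑ B ∈ (univ : Finset (Fin n)).powersetCard b,
        (e + ((1 / (b : ℝ)) * ∑ i ∈ B, a i - (1 / (n : ℝ)) * ∑ i, a i)) ^ 2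
      ≤ e ^ 2 + 1 / (b : ℝ) * ((1 / (n : ℝ)) * ∑ i, a i ^ 2) := by
  rw [average_powersetCard_sq_add_sampleMean_sub_mean hn hb1 hbn]
  have hb : (1 : ℝ) ≤ b := by exact_mod_cast hb1
  have hnR : (2 : ℝ) ≤ n := by exact_mod_cast hn
  have hcoeff : ((n : ℝ) - b) / (b * ((n : ℝ) - 1)) ≤ 1 / (b : ℝ) := by
    rw [div_le_div_iff₀ (mul_pos (by linarith) (by linarith)) (by linarith)]
    nlinarith
  have hsq := sum_sq_sub_mean_le_sum_sq (by omega) a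
  gcongr

/-- **Conditional one-step variance bound for the PAGE estimator, block `j`.**
With probability `p` the estimator is a minibatch gradient over a uniformly random
`b`-subset `B`, and with probability `1 − p` it is the recursive update
`h + (1/b')∑_{i∈B'}(∇^j fᵢ(u) − ∇^j fᵢ(w))` over a uniformly random `b'`-subset
`B'`; the left-hand side is its conditional expected squared error (in the
`‖·‖_{Λ_j^{-1}}` norm, with `γ` the diagonal of `Λ`) for estimating `∇^j f(u)`,
where `f = (1/n)∑ᵢ fᵢ`. -/
theorem stmt_12 (d m n : ℕ) (hm : 1 ≤ m) (hn : 2 ≤ n)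
    (bl : Fin d → Fin m) (hmono : Monotone bl) (hsurj : Function.Surjective bl)
    (γ : Fin d → ℝ) (hγ : ∀ i, 0 < γ i)
    (fi : Fin n → EuclideanSpace ℝ (Fin d) → ℝ)
    (fi' : Fin n → EuclideanSpace ℝ (Fin d) → EuclideanSpace ℝ (Fin d))
    (hfi : ∀ i x, HasGradientAt (fi i) (fi' i x) x)
    (b b' : ℕ) (hb1 : 1 ≤ b) (hbn : b ≤ n) (hb'1 : 1 ≤ b') (hb'n : b' ≤ n)
    (p : ℝ) (hp0 : 0 ≤ p) (hp1 : p ≤ 1)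
    (j : Fin m) (u w : EuclideanSpace ℝ (Fin d)) (h : Fin d → ℝ) :
    p * (1 / (n.choose b : ℝ)) *
        ∑ B ∈ (univ : Finset (Fin n)).powersetCard b,
          ∑ c ∈ univ.filter (fun c => bl c = j),
            ((1 / (b : ℝ)) * ∑ i ∈ B, fi' i u c
              - (1 / (n : ℝ)) * ∑ i, fi' i u c) ^ 2 / γ c
      + (1 - p) * (1 / (n.choose b' : ℝ)) *
          ∑ B' ∈ (univ : Finset (Fin n)).powersetCard b',
            ∑ c ∈ univ.filter (fun c => bl c = j),
              (h c + (1 / (b' : ℝ)) * ∑ i ∈ B', (fi' i u c - fi' i w c)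
                - (1 / (n : ℝ)) * ∑ i, fi' i u c) ^ 2 / γ c
    ≤ p * ((n : ℝ) - b) / (b * ((n : ℝ) - 1)) *
          ((1 / (n : ℝ)) * ∑ i, ∑ c ∈ univ.filter (fun c => bl c = j),
            (fi' i u c - (1 / (n : ℝ)) * ∑ i', fi' i' u c) ^ 2 / γ c)
        + (1 - p) * ∑ c ∈ univ.filter (fun c => bl c = j),
            (h c - (1 / (n : ℝ)) * ∑ i, fi' i w c) ^ 2 / γ c
        + ((1 - p) / (b' : ℝ)) *
            ((1 / (n : ℝ)) * ∑ i, ∑ c ∈ univ.filter (fun c => bl c = j),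
              (fi' i u c - fi' i w c) ^ 2 / γ c) := by
  set S := univ.filter (fun c => bl c = j)
  have hminibatch : (1 / (n.choose b : ℝ)) * ∑ B ∈ (univ : Finset (Fin n)).powersetCard b,
        ∑ c ∈ S, ((1 / (b : ℝ)) * ∑ i ∈ B, fi' i u c - (1 / (n : ℝ)) * ∑ i, fi' i u c) ^ 2 / γ c
      = ((n : ℝ) - b) / (b * ((n : ℝ) - 1)) * ((1 / (n : ℝ)) * ∑ i, ∑ c ∈ S,
          (fi' i u c - (1 / (n : ℝ)) * ∑ i', fi' i' u c) ^ 2 / γ c) := by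
    rw [sum_comm, sum_comm (s := (univ : Finset (Fin n))), mul_sum, mul_sum, mul_sum]
    refine sum_congr rfl fun c _ => ?_
    have hvar := average_powersetCard_sq_add_sampleMean_sub_mean hn hb1 hbn (fun i => fi' i u c) 0
    simp only [zero_add, ne_eq, OfNat.ofNat_ne_zero, not_false_eq_true, zero_pow] at hvar
    rw [← sum_div, ← sum_div, ← mul_div_assoc, hvar]
    ring
  have hrecursive : (1 / (n.choose b' : ℝ)) * ∑ B' ∈ (univ : Finset (Fin n)).powersetCard b',
        ∑ c ∈ S, (h c + (1 / (b' : ℝ)) * ∑ i ∈ B', (fi' i u c - fi' i w c)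
          - (1 / (n : ℝ)) * ∑ i, fi' i u c) ^ 2 / γ c
      ≤ ∑ c ∈ S, (h c - (1 / (n : ℝ)) * ∑ i, fi' i w c) ^ 2 / γ c
        + 1 / (b' : ℝ) * ((1 / (n : ℝ)) * ∑ i, ∑ c ∈ S, (fi' i u c - fi' i w c) ^ 2 / γ c) := by
    rw [sum_comm, sum_comm (s := (univ : Finset (Fin n))), mul_sum, mul_sum, mul_sum,
      ← sum_add_distrib]
    refine sum_le_sum fun c _ => ?_
    have hvar := average_powersetCard_sq_add_sampleMean_sub_mean_le hn hb'1 hb'n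
      (fun i => fi' i u c - fi' i w c) (h c - (1 / (n : ℝ)) * ∑ i, fi' i w c)
    have herror : ∀ B' : Finset (Fin n),
        h c - (1 / (n : ℝ)) * ∑ i, fi' i w c + ((1 / (b' : ℝ)) * ∑ i ∈ B', (fi' i u c - fi' i w c)
          - (1 / (n : ℝ)) * ∑ i, (fi' i u c - fi' i w c))
        = h c + (1 / (b' : ℝ)) * ∑ i ∈ B', (fi' i u c - fi' i w c)
          - (1 / (n : ℝ)) * ∑ i, fi' i u c := by
      intro B'
      rw [sum_sub_distrib (s := univ)]
      ring
    simp only [herror] at hvar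
    rw [← sum_div, ← sum_div, ← mul_div_assoc]
    refine (div_le_div_of_nonneg_right hvar (hγ c).le).trans_eq ?_
    ring
  have hq : 0 ≤ 1 - p := by linarith
  have hscaled := mul_le_mul_of_nonneg_left hrecursive hq
  rw [mul_assoc p, hminibatch, mul_assoc (1 - p)]
  refine (add_le_add_right hscaled _).trans_eq ?_
  ring
end

section
/- Let n ≥ 2 and 1 ≤ b ≤ n be integers, b' ≥ 1 an integer, p ∈ (0,1], σ ≥ 0, L̂ ≥ 0, L̃ ≥ 0, and set c₀ := 2(1−p)L̂/(pb') + L̂ + (2/p)(p(n−b)/(b(n−1)) + (1−p)/b')·L̃. Let η > 0 satisfy c₀η² + η ≤ 1. Let F* ∈ ℝ and let (r_k)_{k≥0}, (u_k)_{k≥0}, (v_k)_{k≥0}, (s_k)_{k≥1} be real sequences with r_k ≥ F*, u_k ≥ 0, v_k ≥ 0, s_k ≥ 0 for all k, v_0 = 0, u_0 ≤ (n−b)σ²/(b(n−1)), and such that for all k ≥ 1: r_k ≤ r_{k−1} − (1/2)(1/η − 1 − L̂η)v_k + (η/2)u_k − (η/4)s_k, and u_k ≤ 2p(n−b)σ²/(b(n−1))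 + 2(p(n−b)/(b(n−1)) + (1−p)/b')·L̃·v_k + (1−p)u_{k−1} + (2(1−p)L̂/b')·v_{k−1}. Then for every integer K ≥ 1: (1/K)Σ_{k=1}^K s_k ≤ 4(r_0 − F*)/(ηK) + 2(1−p)(n−b)σ²/(pb(n−1)K) + 4(n−b)σ²/(b(n−1)). -/
open Finset

/-- One-step decrease of the potential `r + η(1-p)/(2p) u + ηC/(2p) v`. -/
lemma potential_descent {p η L A B C r r' u u' v v' s' : ℝ} (hp : 0 < p) (hη : 0 < η)
    (hstep : (C / p + L + B / p) * η ^ 2 + η ≤ 1) (hv' : 0 ≤ v')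
    (hr : r' ≤ r - (1 / 2) * (1 / η - 1 - L * η) * v' + (η / 2) * u' - (η / 4) * s')
    (hu : u' ≤ 2 * p * A + B * v' + (1 - p) * u + C * v) :
    r' + η * (1 - p) / (2 * p) * u' + η * C / (2 * p) * v' + η / 4 * s' ≤
      r + η * (1 - p) / (2 * p) * u + η * C / (2 * p) * v + η * A := by
  have hcoef : η * (C / p + L + B / p) ≤ 1 / η - 1 := by
    have h : 1 / η - 1 - η * (C / p + L + B / p) =
        (1 - ((C / p + L + B / p) * η ^ 2 + η)) / η := by
      field_simp
      ring
    have : 0 ≤ (1 - ((C / p + L + B / p) * η ^ 2 + η)) / η :=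
      div_nonneg (by linarith) hη.le
    linarith
  have hv := mul_le_mul_of_nonneg_right hcoef hv'
  have hu := mul_le_mul_of_nonneg_left hu (by positivity : 0 ≤ η / (2 * p))
  have e₁ : η / (2 * p) * u' = η * (1 - p) / (2 * p) * u' + η / 2 * u' := by
    field_simp
    ring
  have e₂ : η / (2 * p) * (2 * p * A + B * v' + (1 - p) * u + C * v) =
      η * A + η * (B / p) * v' / 2 + η * (1 - p) / (2 * p) * u + η * C / (2 * p) * v := by
    field_simp
  have e₃ : η * C / (2 * p) * v' = η * (C / p) * v' / 2 := by
    field_simp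
  linarith

/-- Telescoping a potential that decreases by `a * s` up to an additive error `d`. -/
lemma sum_Icc_le_of_potential_descent {Φ s : ℕ → ℝ} {a d : ℝ}
    (h : ∀ k, Φ (k + 1) + a * s (k + 1) ≤ Φ k + d) (K : ℕ) :
    Φ K + a * ∑ k ∈ Icc 1 K, s k ≤ Φ 0 + K * d := by
  induction K with
  | zero => simp
  | succ K ih =>
    rw [sum_Icc_succ_top (by omega)]
    push_cast
    linarith [h K]

/-- **Convergence of VR-CCD** (Theorem 2), stated as a recursion on real sequences.
`r k` abstracts `E[F(x_k)]`, `u k` the expected gradient-estimator error,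
`v k` the expected squared step `E[‖x_k − x_{k−1}‖²_Λ]`, and `s k` the expected
squared generalized gradient norm `E[dist²(∂F(x_k), 0)]`. -/
theorem stmt_14 (n b b' : ℕ) (hn : 2 ≤ n) (hb1 : 1 ≤ b) (hbn : b ≤ n) (hb' : 1 ≤ b')
    (p : ℝ) (hp0 : 0 < p) (hp1 : p ≤ 1)
    (σ Lhat Ltil : ℝ) (hσ : 0 ≤ σ) (hLhat : 0 ≤ Lhat) (hLtil : 0 ≤ Ltil)
    (c0 : ℝ)
    (hc0 : c0 = 2 * (1 - p) * Lhat / (p * b') + Lhat +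
      (2 / p) * (p * ((n : ℝ) - b) / (b * ((n : ℝ) - 1)) + (1 - p) / b') * Ltil)
    (η : ℝ) (hη : 0 < η) (hηc : c0 * η ^ 2 + η ≤ 1)
    (Fstar : ℝ) (r u v s : ℕ → ℝ)
    (hrlb : ∀ k, Fstar ≤ r k) (hu : ∀ k, 0 ≤ u k) (hv : ∀ k, 0 ≤ v k)
    (hs : ∀ k, 0 ≤ s (k + 1))
    (hv0 : v 0 = 0) (hu0 : u 0 ≤ ((n : ℝ) - b) * σ ^ 2 / (b * ((n : ℝ) - 1)))
    (hrec1 : ∀ k : ℕ, r (k + 1) ≤ r k - (1 / 2) * (1 / η - 1 - Lhat * η) * v (k + 1)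
      + (η / 2) * u (k + 1) - (η / 4) * s (k + 1))
    (hrec2 : ∀ k : ℕ, u (k + 1) ≤ 2 * p * ((n : ℝ) - b) * σ ^ 2 / (b * ((n : ℝ) - 1))
      + 2 * (p * ((n : ℝ) - b) / (b * ((n : ℝ) - 1)) + (1 - p) / b') * Ltil * v (k + 1)
      + (1 - p) * u k + (2 * (1 - p) * Lhat / b') * v k)
    (K : ℕ) (hK : 1 ≤ K) :
    (1 / (K : ℝ)) * ∑ k ∈ Finset.Icc 1 K, s k ≤
      4 * (r 0 - Fstar) / (η * K)
        + 2 * (1 - p) * ((n : ℝ) - b) * σ ^ 2 / (p * b * ((n : ℝ) - 1) * K)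
        + 4 * ((n : ℝ) - b) * σ ^ 2 / (b * ((n : ℝ) - 1)) := by
  have hnR : (0 : ℝ) < (n : ℝ) - 1 := by
    have : (2 : ℝ) ≤ n := by exact_mod_cast hn
    linarith
  have hbR : (0 : ℝ) < b := by exact_mod_cast hb1
  have hb'R : (0 : ℝ) < b' := by exact_mod_cast hb'
  have hKR : (0 : ℝ) < K := by exact_mod_cast hK
  have hq : 0 ≤ 1 - p := by linarith
  set A : ℝ := ((n : ℝ) - b) * σ ^ 2 / (b * ((n : ℝ) - 1)) with hA
  set B : ℝ := 2 * (p * ((n : ℝ) - b) / (b * ((n : ℝ) - 1)) + (1 - p) / b') * Ltil with hB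
  set C : ℝ := 2 * (1 - p) * Lhat / b' with hC
  have hC0 : 0 ≤ C := by positivity
  have hc : c0 = C / p + Lhat + B / p := by
    rw [hc0, hB, hC]
    field_simp
  rw [hc] at hηc
  have hsum := sum_Icc_le_of_potential_descent
    (Φ := fun k => r k + η * (1 - p) / (2 * p) * u k + η * C / (2 * p) * v k)
    (fun k => potential_descent (A := A) hp0 hη hηc (hv (k + 1)) (hrec1 k)
      ((hrec2 k).trans_eq (by rw [hA]; ring))) K
  simp only [hv0, mul_zero, add_zero] at hsum
  have hΦu : 0 ≤ η * (1 - p) / (2 * p) * u K := mul_nonneg (by positivity) (hu K)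
  have hΦv : 0 ≤ η * C / (2 * p) * v K := mul_nonneg (by positivity) (hv K)
  have hΦ0 := mul_le_mul_of_nonneg_left hu0 (by positivity : 0 ≤ η * (1 - p) / (2 * p))
  have hbound : η / 4 * ∑ k ∈ Icc 1 K, s k ≤
      r 0 - Fstar + η * (1 - p) / (2 * p) * A + K * (η * A) := by
    linarith [hrlb K]
  calc (1 / (K : ℝ)) * ∑ k ∈ Icc 1 K, s k
      = 4 / (η * K) * (η / 4 * ∑ k ∈ Icc 1 K, s k) := by field_simp
    _ ≤ 4 / (η * K) * (r 0 - Fstar + η * (1 - p) / (2 * p) * A + K * (η * A)) :=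
        mul_le_mul_of_nonneg_left hbound (by positivity)
    _ = _ := by
        rw [hA]
        field_simp
        ring
end

section
/- Let n ≥ 2 and 1 ≤ b ≤ n be integers, b' ≥ 1 an integer, p ∈ (0,1], σ ≥ 0, L̂ ≥ 0, L̃ ≥ 0, μ > 0, and set c₀ := L̂ + 4L̂/(pb') + (4L̃/p)(p(n−b)/(b(n−1)) + (1−p)/b'). Let η > 0 satisfy c₀η² + η ≤ 1 and ημ(1−p) ≤ p. Let F* ∈ ℝ and let (r_k)_{k≥0}, (u_k)_{k≥0}, (v_k)_{k≥0}, (s_k)_{k≥1} be real sequences with r_k ≥ F*, u_k ≥ 0, v_k ≥ 0, s_k ≥ 0 for all k, v_0 = 0, u_0 ≤ (n−b)σ²/(b(n−1)), and such that for all k ≥ 1: r_k ≤ r_{k−1} − (1/2)(1/η − 1 − L̂η)v_k + (η/2)u_k − (η/4)s_k, u_k ≤ 2p(n−b)σ²/(b(n−1)) + 2(p(n−b)/(b(n−1)) + (1−p)/b')·L̃·v_k + (1−p)u_{k−1} + (2(1−p)L̂/b')·v_{k−1}, and s_k ≥ 2μ(r_k − F*). Then for every integer K ≥ 1: r_K −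 F* ≤ (1 + ημ/2)^{−K}·(r_0 − F* + σ²η(1−p)(n−b)/(pb(n−1))) + 4(n−b)σ²/(bμ(n−1)). -/
open Finset

/-- If `θ Φ_{k+1} ≤ Φ_k + (θ - 1) c` with `θ > 0`, then `Φ` contracts geometrically up to the
additive error `c`. -/
theorem le_inv_pow_mul_add_of_contraction {θ C c : ℝ} {Φ : ℕ → ℝ} (hθ : 0 < θ)
    (h0 : Φ 0 ≤ C + c) (hstep : ∀ k, θ * Φ (k + 1) ≤ Φ k + (θ - 1) * c) (K : ℕ) :
    Φ K ≤ (θ ^ K)⁻¹ * C + c := by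
  induction K with
  | zero => simpa using h0
  | succ k ih =>
    refine le_of_mul_le_mul_left ?_ hθ
    have hpow : θ * ((θ ^ (k + 1))⁻¹ * C + c) = (θ ^ k)⁻¹ * C + θ * c := by
      field_simp
      ring
    rw [hpow]
    linarith [hstep k]

/-- One-step contraction of the Lyapunov function `R + (η (1 - p) / p) u + (η z / p) v`, where
`R'`, `u'`, `v'` are the values after the step. -/
theorem lyapunov_step {p η μ N w z d R R' u u' v v' : ℝ} (hp0 : 0 < p) (hη : 0 < η)
    (hημ : η * μ * (1 - p) ≤ p) (hu' : 0 ≤ u') (hv' : 0 ≤ v')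
    (hd : (1 + η * μ / 2) * (η / p * z) + η / p * w ≤ d)
    (hR : (1 + η * μ / 2) * R' ≤ R - d * v' + η / 2 * u')
    (hvar : u' ≤ 2 * p * N + w * v' + (1 - p) * u + z * v) :
    (1 + η * μ / 2) * (R' + η / p * (1 - p) * u' + η / p * z * v') ≤
      R + η / p * (1 - p) * u + η / p * z * v + 2 * η * N := by
  have hcoef : η / 2 + (1 + η * μ / 2) * (η / p * (1 - p)) ≤ η / p := by
    have hq : η * μ * (1 - p) / p ≤ 1 := (div_le_one hp0).2 hημ
    have hsplit : η / p - (η / 2 + (1 + η * μ / 2) * (η / p * (1 - p))) =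
        η / 2 * (1 - η * μ * (1 - p) / p) := by
      field_simp
      ring
    have hnonneg : 0 ≤ η / 2 * (1 - η * μ * (1 - p) / p) :=
      mul_nonneg (by positivity) (by linarith)
    linarith
  have hu_le := mul_le_mul_of_nonneg_right hcoef hu'
  have hv_le := mul_le_mul_of_nonneg_right hd hv'
  have hvar' := mul_le_mul_of_nonneg_left hvar (div_pos hη hp0).le
  have hnoise : η / p * (2 * p * N) = 2 * η * N := by field_simp
  linarith

/-- **Linear convergence of VR-CCD under the PŁ condition**, stated as a recursion on
real sequences. `r k` abstracts `E[F(x_k)]`, `u k` the expected gradient-estimator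
error, `v k` the expected squared step, and `s k` the expected squared generalized
gradient norm; `s k ≥ 2μ(r k − F*)` abstracts the PŁ condition. -/
theorem stmt_15 (n b b' : ℕ) (hn : 2 ≤ n) (hb1 : 1 ≤ b) (hbn : b ≤ n) (hb' : 1 ≤ b')
    (p : ℝ) (hp0 : 0 < p) (hp1 : p ≤ 1)
    (σ Lhat Ltil μ : ℝ) (hσ : 0 ≤ σ) (hLhat : 0 ≤ Lhat) (hLtil : 0 ≤ Ltil) (hμ : 0 < μ)
    (c0 : ℝ)
    (hc0 : c0 = Lhat + 4 * Lhat / (p * b') +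
      (4 * Ltil / p) * (p * ((n : ℝ) - b) / (b * ((n : ℝ) - 1)) + (1 - p) / b'))
    (η : ℝ) (hη : 0 < η) (hηc : c0 * η ^ 2 + η ≤ 1) (hημ : η * μ * (1 - p) ≤ p)
    (Fstar : ℝ) (r u v s : ℕ → ℝ)
    (hrlb : ∀ k, Fstar ≤ r k) (hu : ∀ k, 0 ≤ u k) (hv : ∀ k, 0 ≤ v k)
    (hs : ∀ k, 0 ≤ s (k + 1))
    (hv0 : v 0 = 0) (hu0 : u 0 ≤ ((n : ℝ) - b) * σ ^ 2 / (b * ((n : ℝ) - 1)))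
    (hrec1 : ∀ k : ℕ, r (k + 1) ≤ r k - (1 / 2) * (1 / η - 1 - Lhat * η) * v (k + 1)
      + (η / 2) * u (k + 1) - (η / 4) * s (k + 1))
    (hrec2 : ∀ k : ℕ, u (k + 1) ≤ 2 * p * ((n : ℝ) - b) * σ ^ 2 / (b * ((n : ℝ) - 1))
      + 2 * (p * ((n : ℝ) - b) / (b * ((n : ℝ) - 1)) + (1 - p) / b') * Ltil * v (k + 1)
      + (1 - p) * u k + (2 * (1 - p) * Lhat / b') * v k)
    (hPL : ∀ k : ℕ, 2 * μ * (r (k + 1) - Fstar) ≤ s (k + 1))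
    (K : ℕ) (hK : 1 ≤ K) :
    r K - Fstar ≤
      ((1 + η * μ / 2) ^ K)⁻¹ *
          (r 0 - Fstar + σ ^ 2 * η * (1 - p) * ((n : ℝ) - b) / (p * b * ((n : ℝ) - 1)))
        + 4 * ((n : ℝ) - b) * σ ^ 2 / (b * μ * ((n : ℝ) - 1)) := by
  have hb0 : (0 : ℝ) < b := by exact_mod_cast hb1
  have hb'0 : (0 : ℝ) < b' := by exact_mod_cast hb'
  have hn1 : (0 : ℝ) < (n : ℝ) - 1 := by
    have : (2 : ℝ) ≤ n := by exact_mod_cast hn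
    linarith
  set N : ℝ := ((n : ℝ) - b) * σ ^ 2 / (b * ((n : ℝ) - 1)) with hN
  set D : ℝ := p * ((n : ℝ) - b) / (b * ((n : ℝ) - 1)) + (1 - p) / b'
  have hp1' : 0 ≤ 1 - p := by linarith
  have hN0 : 0 ≤ N := by
    have : (b : ℝ) ≤ n := by exact_mod_cast hbn
    exact div_nonneg (mul_nonneg (by linarith) (sq_nonneg σ)) (by positivity)
  set z : ℝ := 2 * (1 - p) * Lhat / b' with hz
  have hz0 : 0 ≤ z := by positivity
  have hd : (1 + η * μ / 2) * (η / p * z) + η / p * (2 * D * Ltil) ≤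
      1 / 2 * (1 / η - 1 - Lhat * η) := by
    have hcontr : (1 + η * μ / 2) * (1 - p) ≤ 1 := by linarith
    have hscale : 0 ≤ 2 * η * Lhat / (p * b') := by positivity
    have hle := mul_le_mul_of_nonneg_right hcontr hscale
    have hzeq : (1 + η * μ / 2) * (η / p * z) =
        (1 + η * μ / 2) * (1 - p) * (2 * η * Lhat / (p * b')) := by
      rw [hz]
      field_simp
    have hstep : c0 * η ≤ 1 / η - 1 := by
      have hdiv : c0 * η + 1 ≤ 1 / η := (le_div_iff₀ hη).2 (by linarith)
      linarith
    have hc0η : c0 * η = Lhat * η + 2 * (2 * η * Lhat / (p * b')) +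
        2 * (η / p * (2 * D * Ltil)) := by
      rw [hc0]
      ring
    linarith
  have hbound := le_inv_pow_mul_add_of_contraction
    (Φ := fun k => r k - Fstar + η / p * (1 - p) * u k + η / p * z * v k)
    (θ := 1 + η * μ / 2) (c := 4 * N / μ) (C := r 0 - Fstar + η / p * (1 - p) * N)
    (by positivity)
    (by
      have hu0' := mul_le_mul_of_nonneg_left hu0 (by positivity : 0 ≤ η / p * (1 - p))
      have hc : 0 ≤ 4 * N / μ := by positivity
      simp only [hv0]
      linarith)
    (fun k => by
      have hnoise : (1 + η * μ / 2 - 1) * (4 * N / μ) = 2 * η * N := by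
        field_simp
        ring
      rw [hnoise]
      refine lyapunov_step hp0 hη hημ (hu (k + 1)) (hv (k + 1)) hd ?_ ?_
      · have hs_le := mul_le_mul_of_nonneg_left (hPL k) (by positivity : 0 ≤ η / 4)
        linarith [hrec1 k]
      · have hNp : 2 * p * ((n : ℝ) - b) * σ ^ 2 / (b * ((n : ℝ) - 1)) = 2 * p * N := by
          rw [hN]
          ring
        linarith [hrec2 k]) K
  have hinit : σ ^ 2 * η * (1 - p) * ((n : ℝ) - b) / (p * b * ((n : ℝ) - 1)) =
      η / p * (1 - p) * N := by
    rw [hN]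
    field_simp
  have hlim : 4 * ((n : ℝ) - b) * σ ^ 2 / (b * μ * ((n : ℝ) - 1)) = 4 * N / μ := by
    rw [hN]
    field_simp
  rw [hinit, hlim]
  have huK : 0 ≤ η / p * (1 - p) * u K := mul_nonneg (by positivity) (hu K)
  have hvK : 0 ≤ η / p * z * v K := mul_nonneg (by positivity) (hv K)
  linarith
end
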